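/- arXiv:2310.15064 — 2 statements merged into one kernel-verified Lean document; each statement's English description precedes it below -/
import Mathlib

section
/- For every real number α > 3 and every k ≥ 1, the truncated Thue–Morse morphism h_k is α-free: for every finite binary word w with ce(w) < α, one has ce(h_k(w)) < α. -/
/-- The Thue–Morse word: `tm n` is the parity of the number of 1s in the
binary representation of `n` (`true` = letter 1, `false` = letter 0). -/
def tm (n : ℕ) : Bool := ((Nat.digits 2 n).count 1) % 2 == 1

/-- The factor `t[ℓ..ℓ+k-1]` of the Thue–Morse word. -/
def tmFactor (ℓ k : ℕ) : List Bool := (List.range k).map (fun i => tm (ℓ + i))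

/-- Complement of a binary word (exchange 0 and 1 in every position). -/
def wcompl (w : List Bool) : List Bool := w.map (fun b => !b)

/-- Apply the binary morphism `0 ↦ h0, 1 ↦ h1` to the word `w`. -/
def applyMorph (h0 h1 : List Bool) (w : List Bool) : List Bool :=
  (w.map (fun b => bif b then h1 else h0)).flatten

/-- The Thue–Morse morphism μ : 0 ↦ 01, 1 ↦ 10. -/
def mu : List Bool → List Bool := applyMorph [false, true] [true, false]

/-- `p` is a period of the finite word `w`: `1 ≤ p ≤ |w|` and `w[i] = w[i+p]`
for all `i` with `i + p < |w|`. -/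
def HasPeriodW (w : List Bool) (p : ℕ) : Prop :=
  1 ≤ p ∧ p ≤ w.length ∧ ∀ i, i + p < w.length → w.getD i false = w.getD (i + p) false

/-- The smallest period of `w`. -/
noncomputable def per (w : List Bool) : ℕ := sInf {p | HasPeriodW w p}

/-- The exponent of `w`: `|w| / per(w)`. -/
noncomputable def wexp (w : List Bool) : ℝ := (w.length : ℝ) / (per w : ℝ)

/-- The critical exponent of `w`: supremum of exponents of nonempty factors of `w`. -/
noncomputable def ce (w : List Bool) : ℝ :=
  sSup {r : ℝ | ∃ x : List Bool, x ≠ [] ∧ x <:+: w ∧ r = wexp x}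

/-- A `k`-prefix: the length-`k` prefix of the Thue–Morse word, or its complement. -/
def kPrefix (k : ℕ) (s : List Bool) : Prop :=
  s = tmFactor 0 k ∨ s = wcompl (tmFactor 0 k)

/-- `v` is a finite factor of the Thue–Morse word. -/
def IsTMFactor (v : List Bool) : Prop := ∃ ℓ, v = tmFactor ℓ v.length

/-- The complementary morphism `0 ↦ h0, 1 ↦ complement of h0` is cubefree:
it maps every word of critical exponent `< 3` to a word of critical exponent `< 3`. -/
def CubefreeC (h0 : List Bool) : Prop :=
  ∀ w : List Bool, ce w < 3 → ce (applyMorph h0 (wcompl h0) w) < 3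

/-- The word `x` occurs at position `i` of the word `w`. -/
def OccursAt (x w : List Bool) (i : ℕ) : Prop :=
  i + x.length ≤ w.length ∧ (w.drop i).take x.length = x

theorem tm_two_mul (n : ℕ) : tm (2 * n) = tm n := by
  rcases Nat.eq_zero_or_pos n with rfl | h
  · rfl
  · unfold tm
    rw [Nat.digits_def' (by norm_num) (by omega)]
    simp

theorem tm_two_mul_add_one (n : ℕ) : tm (2 * n + 1) = !tm n := by
  unfold tm
  rw [Nat.digits_def' (by norm_num) (by omega)]
  have h1 : (2 * n + 1) % 2 = 1 := by omega
  have h2 : (2 * n + 1) / 2 = n := by omega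
  rw [h1, h2, List.count_cons_self]
  rcases Nat.mod_two_eq_zero_or_one (List.count 1 (Nat.digits 2 n)) with h | h
  · have : (List.count 1 (Nat.digits 2 n) + 1) % 2 = 1 := by omega
    simp [h, this]
  · have : (List.count 1 (Nat.digits 2 n) + 1) % 2 = 0 := by omega
    simp [h, this]

theorem tm_succ_ne_of_even {n : ℕ} (h : n % 2 = 0) : tm n ≠ tm (n + 1) := by
  obtain ⟨m, rfl⟩ : ∃ m, n = 2 * m := ⟨n / 2, by omega⟩
  rw [tm_two_mul, tm_two_mul_add_one]
  cases tm m <;> decide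

theorem tm_zero : tm 0 = false := by decide
theorem tm_one : tm 1 = true := by simpa [tm_zero] using tm_two_mul_add_one 0
theorem tm_two : tm 2 = true := by simpa [tm_one] using tm_two_mul 1

/-- A word in which all letters of a window of odd length alternate has no equal ends. -/
theorem ne_of_alternating {g : ℕ → Bool} {a p : ℕ} (hp : p % 2 = 1)
    (h : ∀ j < p, g (a + j) ≠ g (a + j + 1)) : g a ≠ g (a + p) := by
  have key : ∀ j ≤ p, g (a + j) = xor (g a) (decide (j % 2 = 1)) := by
    intro j
    induction j with
    | zero => intro _; simp
    | succ j ih =>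
      intro hj
      have h1 := ih (by omega)
      have h2 := h j (by omega)
      rw [h1] at h2
      rw [← Nat.add_assoc]
      rcases Nat.mod_two_eq_zero_or_one j with h3 | h3
      · have h4 : (j + 1) % 2 = 1 := by omega
        simp only [h3, h4] at h2 ⊢
        revert h2
        cases g a <;> cases g (a + j + 1) <;> decide
      · have h4 : (j + 1) % 2 = 0 := by omega
        simp only [h3, h4] at h2 ⊢
        revert h2
        cases g a <;> cases g (a + j + 1) <;> decide
  rw [key p le_rfl, hp]
  cases g a <;> decide

/-- If `g` is a concatenation of blocks `01`, `10`, it has no overlap of odd period. -/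
theorem no_odd_overlap {g : ℕ → Bool} (hg : ∀ n, n % 2 = 0 → g n ≠ g (n + 1)) {a p : ℕ}
    (hp : p % 2 = 1) : ¬ ∀ j ≤ p, g (a + j) = g (a + j + p) := by
  intro h
  refine ne_of_alternating (a := a) hp (fun j hj => ?_) (h 0 (by omega))
  rcases Nat.mod_two_eq_zero_or_one (a + j) with h1 | h1
  · exact hg _ h1
  · have h2 := hg (a + j + p) (by omega)
    rw [← h j hj.le] at h2
    have h3 := h (j + 1) (by omega)
    rw [← Nat.add_assoc] at h3
    rwa [h3, show a + j + 1 + p = a + j + p + 1 by omega]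

theorem tm_overlap_free {p : ℕ} (hp : 1 ≤ p) (a : ℕ) :
    ¬ ∀ j ≤ p, tm (a + j) = tm (a + j + p) := by
  induction p using Nat.strong_induction_on generalizing a with
  | _ p ih =>
    intro h
    rcases Nat.mod_two_eq_zero_or_one p with h1 | h1
    · obtain ⟨q, rfl⟩ : ∃ q, p = 2 * q := ⟨p / 2, by omega⟩
      refine ih q (by omega) (by omega) (a / 2) (fun i hi => ?_)
      have h2 := h (2 * i) (by omega)
      rcases Nat.mod_two_eq_zero_or_one a with h3 | h3
      · rw [show a + 2 * i + 2 * q = 2 * (a / 2 + i + q) by omega,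
          show a + 2 * i = 2 * (a / 2 + i) by omega, tm_two_mul, tm_two_mul] at h2
        exact h2
      · rw [show a + 2 * i + 2 * q = 2 * (a / 2 + i + q) + 1 by omega,
          show a + 2 * i = 2 * (a / 2 + i) + 1 by omega, tm_two_mul_add_one,
          tm_two_mul_add_one] at h2
        exact Bool.not_inj h2
    · exact no_odd_overlap (fun _ => tm_succ_ne_of_even) h1 h

/-- The image of the infinite word `f` under the morphism `h_k`. -/
def tmImage (k : ℕ) (f : ℕ → Bool) (i : ℕ) : Bool := xor (f (i / k)) (tm (i % k))

theorem tmImage_mul_add {k : ℕ} (f : ℕ → Bool) (c : ℕ) {r : ℕ} (hr : r < k) :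
    tmImage k f (c * k + r) = xor (f c) (tm r) := by
  unfold tmImage
  rw [Nat.add_comm, Nat.add_mul_div_right _ _ (by omega), Nat.add_mul_mod_self_right,
    Nat.div_eq_of_lt hr, Nat.mod_eq_of_lt hr, Nat.zero_add]

theorem tmImage_eq_iff {k : ℕ} (f : ℕ → Bool) {a x y : ℕ} (ha : k ∣ a) (hx : x < k)
    (hy : y < k) : tmImage k f (a + x) = tmImage k f (a + y) ↔ tm x = tm y := by
  obtain ⟨c, rfl⟩ := ha
  rw [Nat.mul_comm, tmImage_mul_add f c hx, tmImage_mul_add f c hy]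
  exact Bool.xor_right_inj

theorem tmImage_succ_ne {k : ℕ} (f : ℕ → Bool) {a x : ℕ} (ha : k ∣ a) (hx : x + 1 < k)
    (h : x % 2 = 0) : tmImage k f (a + x) ≠ tmImage k f (a + x + 1) := by
  rw [Nat.add_assoc, Ne, tmImage_eq_iff f ha (by omega) hx]
  exact tm_succ_ne_of_even h

theorem tmImage_one_eq_two {k : ℕ} (f : ℕ → Bool) {a : ℕ} (ha : k ∣ a) (hk : 3 ≤ k) :
    tmImage k f (a + 1) = tmImage k f (a + 2) := by
  rw [tmImage_eq_iff f ha (by omega) (by omega), tm_one, tm_two]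

/-- For odd `k`, the blocks of `h_k` only occur at positions divisible by `k`. -/
theorem tmImage_synchronizing {k : ℕ} (hk : 3 ≤ k) (hodd : k % 2 = 1) (f : ℕ → Bool)
    {a m : ℕ} (ha : k ∣ a) (h : ∀ j < k, tmImage k f (a + j) = tmImage k f (m + j)) :
    k ∣ m := by
  by_contra hm
  have hd : 0 < m % k := Nat.pos_of_ne_zero (fun h0 => hm (Nat.dvd_of_mod_eq_zero h0))
  have hdk : m % k < k := Nat.mod_lt _ (by omega)
  obtain ⟨b, d, hb, hmd, hd0⟩ : ∃ b d, k ∣ b ∧ m = b + d ∧ d = m % k :=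
    ⟨k * (m / k), m % k, dvd_mul_right _ _, (Nat.div_add_mod m k).symm, rfl⟩
  rw [← hd0] at hd hdk
  have hb' : k ∣ b + k := (Nat.dvd_add_right hb).2 dvd_rfl
  have e12 := tmImage_one_eq_two f ha hk
  have f12 := tmImage_one_eq_two f hb' hk
  rcases Nat.mod_two_eq_zero_or_one d with hpar | hpar
  · by_cases h4 : 4 ≤ d
    · have n := tmImage_succ_ne f ha (x := k - d + 1) (by omega) (by omega)
      rw [show a + (k - d + 1) + 1 = a + (k - d + 2) by omega, h _ (by omega),
        h _ (by omega), show m + (k - d + 1) = b + k + 1 by omega,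
        show m + (k - d + 2) = b + k + 2 by omega] at n
      exact n f12
    · have hd2 : d = 2 := by omega
      by_cases h5 : 5 ≤ k
      · have n3 : tmImage k f (b + 3) ≠ tmImage k f (b + 4) := by
          rw [Ne, tmImage_eq_iff f hb (by omega) (by omega),
            show tm 4 = true by simpa [tm_two] using tm_two_mul 2,
            show tm 3 = false by simpa [tm_one] using tm_two_mul_add_one 1]
          decide
        rw [h 1 (by omega), h 2 (by omega), show m + 1 = b + 3 by omega,
          show m + 2 = b + 4 by omega] at e12
        exact n3 e12
      · have n := tmImage_succ_ne f hb' (x := 0) (by omega) (by omega)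
        rw [h 1 (by omega), h 2 (by omega), show m + 1 = b + k + 0 by omega,
          show m + 2 = b + k + 0 + 1 by omega] at e12
        exact n e12
  · by_cases h4 : d + 4 ≤ k
    · have n := tmImage_succ_ne f hb (x := d + 1) (by omega) (by omega)
      rw [h 1 (by omega), h 2 (by omega), show m + 1 = b + (d + 1) by omega,
        show m + 2 = b + (d + 1) + 1 by omega] at e12
      exact n e12
    · have hd2 : k = d + 2 := by omega
      by_cases h5 : 5 ≤ k
      · have n3 : tmImage k f (a + 3) ≠ tmImage k f (a + 4) := by
          rw [Ne, tmImage_eq_iff f ha (by omega) (by omega),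
            show tm 4 = true by simpa [tm_two] using tm_two_mul 2,
            show tm 3 = false by simpa [tm_one] using tm_two_mul_add_one 1]
          decide
        rw [h 3 (by omega), h 4 (by omega), show m + 3 = b + k + 1 by omega,
          show m + 4 = b + k + 2 by omega] at n3
        exact n3 f12
      · have n := tmImage_succ_ne f ha (x := 0) (by omega) (by omega)
        rw [Nat.add_zero, ← Nat.add_zero a, h 0 (by omega), Nat.add_zero,
          h 1 (by omega), show m = b + 1 by omega,
          show b + 1 + 1 = b + 2 by omega] at n
        exact n (tmImage_one_eq_two f hb hk)

theorem tmImage_block_overlap_free {k : ℕ} (f : ℕ → Bool) {a x p : ℕ} (ha : k ∣ a)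
    (hp : 1 ≤ p) (hx : x + 2 * p < k) :
    ¬ ∀ i, a + x ≤ i → i ≤ a + x + p → tmImage k f i = tmImage k f (i + p) := by
  intro h
  refine tm_overlap_free hp x (fun j hj => ?_)
  have h1 := h (a + (x + j)) (by omega) (by omega)
  rw [Nat.add_assoc] at h1
  exact (tmImage_eq_iff f ha (by omega) (by omega)).1 h1

/-- For odd `k`, factors of `h_k`-images of exponent above 3 have period divisible by `k`. -/
theorem dvd_period_of_odd {k : ℕ} (hk : 3 ≤ k) (hodd : k % 2 = 1) (f : ℕ → Bool)
    {s p : ℕ} (hp : 1 ≤ p)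
    (h : ∀ i, s ≤ i → i ≤ s + 2 * p → tmImage k f i = tmImage k f (i + p)) : k ∣ p := by
  by_contra hkp
  obtain ⟨a, ha, hsa, hask⟩ : ∃ a, k ∣ a ∧ s ≤ a ∧ a < s + k := by
    refine ⟨k * ((s + k - 1) / k), dvd_mul_right _ _, ?_, ?_⟩ <;>
    · have h1 := Nat.div_add_mod (s + k - 1) k
      have h2 := Nat.mod_lt (s + k - 1) (show 0 < k by omega)
      omega
  have hak : k ∣ a + k := (Nat.dvd_add_right ha).2 dvd_rfl
  have hfwd : s + 2 * p + 1 < a + k := by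
    by_contra hc
    refine hkp ((Nat.dvd_add_right ha).1
      (tmImage_synchronizing hk hodd f (m := a + p) ha (fun j hj => ?_)))
    rw [h (a + j) (by omega) (by omega)]
    congr 1; omega
  obtain ⟨b, hb, hba⟩ | ha0 : (∃ b, k ∣ b ∧ b + k = a) ∨ a = 0 := by
    obtain ⟨c, rfl⟩ := ha
    rcases c with _ | c
    · right; simp
    · left; exact ⟨k * c, dvd_mul_right _ _, by ring⟩
  swap
  · exact tmImage_block_overlap_free f (x := 0) ha hp (by omega)
      (fun i h1 h2 => h i (by omega) (by omega))
  have hu : a ≤ s + 2 * p := by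
    by_contra hc
    exact tmImage_block_overlap_free f (x := s - b) (p := p) hb hp (by omega)
      (fun i h1 h2 => h i (by omega) (by omega))
  have a12 := tmImage_one_eq_two f ha hk
  have n02 : tmImage k f (a + 0) ≠ tmImage k f (a + 2) := by
    rw [Ne, tmImage_eq_iff f ha (by omega) (by omega), tm_zero, tm_two]
    decide
  by_cases hcase : s + 3 * p + 1 ≤ a + k
  · have hv : s + p + 1 ≤ a := by
      by_contra hc
      exact tmImage_block_overlap_free f (x := 0) (p := p) ha hp (by omega)
        (fun i h1 h2 => h i (by omega) (by omega))
    rcases Nat.mod_two_eq_zero_or_one p with hpar | hpar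
    · by_cases hp2 : p = 2
      · rw [h _ (by omega) (by omega), hp2] at n02
        exact n02 rfl
      · have n := tmImage_succ_ne f hb (x := k + 1 - p) (by omega) (by omega)
        rw [h _ (by omega) (by omega), h (b + (k + 1 - p) + 1) (by omega) (by omega),
          show b + (k + 1 - p) + p = a + 1 by omega,
          show b + (k + 1 - p) + 1 + p = a + 2 by omega] at n
        exact n a12
    · by_cases hp1 : p = 1
      · have n := tmImage_succ_ne f ha (x := 0) (by omega) (by omega)
        rw [h _ (by omega) (by omega), hp1] at n
        exact n rfl
      · by_cases hvl : a + p + 3 ≤ s + 3 * p + 1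
        · have n := tmImage_succ_ne f ha (x := p + 1) (by omega) (by omega)
          rw [h _ (by omega) (by omega), h (a + 2) (by omega) (by omega),
            show a + 1 + p = a + (p + 1) by omega,
            show a + 2 + p = a + (p + 1) + 1 by omega] at a12
          exact n a12
        · have n := tmImage_succ_ne f hb (x := k + 1 - 2 * p) (by omega) (by omega)
          rw [h _ (by omega) (by omega), h (b + (k + 1 - 2 * p) + 1) (by omega) (by omega),
            h (b + (k + 1 - 2 * p) + p) (by omega) (by omega),
            h (b + (k + 1 - 2 * p) + 1 + p) (by omega) (by omega),
            show b + (k + 1 - 2 * p) + p + p = a + 1 by omega,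
            show b + (k + 1 - 2 * p) + 1 + p + p = a + 2 by omega] at n
          exact n a12
  · have hbwd : a < s + p := by
      by_contra hc
      have h1 : k ∣ a - p := by
        refine tmImage_synchronizing hk hodd f (m := a - p) ha (fun j hj => ?_)
        rw [h (a - p + j) (by omega) (by omega)]
        congr 1; omega
      refine hkp ((Nat.dvd_add_right h1).1 ?_)
      rwa [show a - p + p = a by omega]
    rcases Nat.mod_two_eq_zero_or_one p with hpar | hpar
    · by_cases hp2 : p = 2
      · rw [h _ (by omega) (by omega), hp2] at n02
        exact n02 rfl
      · by_cases hvl : a + k + 3 ≤ s + 3 * p + 1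
        · have n := tmImage_succ_ne f ha (x := k + 1 - p) (by omega) (by omega)
          rw [h _ (by omega) (by omega), h (a + (k + 1 - p) + 1) (by omega) (by omega),
            show a + (k + 1 - p) + p = a + k + 1 by omega,
            show a + (k + 1 - p) + 1 + p = a + k + 2 by omega] at n
          exact n (tmImage_one_eq_two f hak hk)
        · exact tmImage_block_overlap_free f (x := 0) (p := p) ha hp (by omega)
            (fun i h1 h2 => h i (by omega) (by omega))
    · have n := tmImage_succ_ne f ha (x := p + 1) (by omega) (by omega)
      rw [h _ (by omega) (by omega), h (a + 2) (by omega) (by omega),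
        show a + 1 + p = a + (p + 1) by omega,
        show a + 2 + p = a + (p + 1) + 1 by omega] at a12
      exact n a12

theorem dvd_period_of_two (f : ℕ → Bool) {s p : ℕ}
    (h : ∀ i, s ≤ i → i ≤ s + 2 * p → tmImage 2 f i = tmImage 2 f (i + p)) : 2 ∣ p := by
  by_contra hp
  refine no_odd_overlap (g := tmImage 2 f) (a := s) (p := p) (fun n hn => ?_) (by omega)
    (fun j hj => h _ (by omega) (by omega))
  exact tmImage_succ_ne f (x := 0) (Nat.dvd_of_mod_eq_zero hn) (by norm_num) rfl

/-- Every factor of the prefix of length `L` of `f` has exponent less than `α`. -/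
def PowerFreeUpTo (α : ℝ) (L : ℕ) (f : ℕ → Bool) : Prop :=
  ∀ s n p : ℕ, 1 ≤ p → s + n ≤ L → (∀ i, s ≤ i → i + p < s + n → f i = f (i + p)) →
    (n : ℝ) < α * p

theorem PowerFreeUpTo.congr {α : ℝ} {L : ℕ} {f g : ℕ → Bool} (hf : PowerFreeUpTo α L f)
    (h : ∀ i < L, f i = g i) : PowerFreeUpTo α L g := by
  intro s n p hp hL hper
  refine hf s n p hp hL (fun i h1 h2 => ?_)
  rw [h i (by omega), h (i + p) (by omega)]
  exact hper i h1 h2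

theorem PowerFreeUpTo.tmImage_of_dvd {α : ℝ} (hα : 3 < α) {L k : ℕ} (hk : 1 ≤ k)
    {f : ℕ → Bool} (hf : PowerFreeUpTo α L f)
    (hdvd : ∀ s p, 1 ≤ p →
      (∀ i, s ≤ i → i ≤ s + 2 * p → tmImage k f i = tmImage k f (i + p)) → k ∣ p) :
    PowerFreeUpTo α (k * L) (tmImage k f) := by
  intro s n p hp hL hper
  have hpR : (1 : ℝ) ≤ p := by exact_mod_cast hp
  by_contra! hn
  have hn3 : 3 * p < n := by
    have : (3 : ℝ) * p < n := by nlinarith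
    exact_mod_cast this
  obtain ⟨q, rfl⟩ := hdvd s p hp (fun i h1 h2 => hper i h1 (by omega))
  have hs := Nat.div_add_mod s k
  have hsk := Nat.mod_lt s (show 0 < k by omega)
  have he := Nat.div_add_mod (s + n - 1) k
  have hek := Nat.mod_lt (s + n - 1) (show 0 < k by omega)
  set a := s / k
  set b := (s + n - 1) / k
  have hab : a ≤ b := Nat.div_le_div_right (by omega)
  have hbL : b < L := Nat.div_lt_of_lt_mul (by omega)
  have hq : 1 ≤ q := Nat.pos_of_mul_pos_left hp
  have hlt := hf a (b + 1 - a) q hq (by omega) (fun i h1 h2 => ?_)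
  · have hnk : n ≤ k * (b + 1 - a) := by
      have : k * (b + 1 - a) + k * a = k * b + k := by
        rw [← Nat.mul_add, show b + 1 - a + a = b + 1 by omega]; ring
      omega
    have hnkR : (n : ℝ) ≤ k * ((b + 1 - a : ℕ) : ℝ) := by exact_mod_cast hnk
    have hkR : (0 : ℝ) < k := by exact_mod_cast hk
    push_cast at hn
    nlinarith [mul_lt_mul_of_pos_left hlt hkR]
  · have hib : k * (i + q) ≤ k * b := Nat.mul_le_mul_left k (by omega)
    have hia : k * a ≤ k * i := Nat.mul_le_mul_left k h1
    rw [Nat.mul_add] at hib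
    obtain ⟨r, hr, hr1, hr2⟩ : ∃ r < k, s ≤ i * k + r ∧ i * k + r + k * q < s + n := by
      rw [Nat.mul_comm i k]
      rcases h1.eq_or_lt with rfl | hlt
      · exact ⟨s % k, hsk, by omega, by omega⟩
      · have : k * (a + 1) ≤ k * i := Nat.mul_le_mul_left k hlt
        rw [Nat.mul_add] at this
        exact ⟨0, by omega, by omega, by omega⟩
    have h3 := hper _ hr1 hr2
    rw [show i * k + r + k * q = (i + q) * k + r by ring, tmImage_mul_add f _ hr,
      tmImage_mul_add f _ hr] at h3
    exact Bool.xor_left_inj.1 h3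

theorem tmImage_two_mul (m : ℕ) (f : ℕ → Bool) :
    tmImage (2 * m) f = tmImage 2 (tmImage m f) := by
  funext i
  have h1 : i % (2 * m) = 2 * (i / 2 % m) + i % 2 := by
    rw [Nat.mod_mul]; ring
  unfold tmImage
  rw [← Nat.div_div_eq_div_mul, h1, Bool.xor_assoc]
  congr 1
  rcases Nat.mod_two_eq_zero_or_one i with h | h <;> rw [h]
  · rw [Nat.add_zero, tm_two_mul, tm_zero, Bool.xor_false]
  · rw [tm_two_mul_add_one, tm_one, Bool.xor_true]

theorem PowerFreeUpTo.tmImage {α : ℝ} (hα : 3 < α) {k : ℕ} (hk : 1 ≤ k) {L : ℕ}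
    {f : ℕ → Bool} (hf : PowerFreeUpTo α L f) :
    PowerFreeUpTo α (k * L) (tmImage k f) := by
  induction k using Nat.strong_induction_on with
  | _ k ih =>
    rcases Nat.mod_two_eq_zero_or_one k with hpar | hpar
    · obtain ⟨m, rfl⟩ : ∃ m, k = 2 * m := ⟨k / 2, by omega⟩
      rw [tmImage_two_mul, Nat.mul_assoc]
      exact (ih m (by omega) (by omega)).tmImage_of_dvd hα (by norm_num)
        (fun s p _ => dvd_period_of_two _)
    · refine hf.tmImage_of_dvd hα hk (fun s p hp h => ?_)
      by_cases hk3 : 3 ≤ k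
      · exact dvd_period_of_odd hk3 hpar f hp h
      · rw [show k = 1 by omega]
        exact one_dvd p

theorem finite_exponents (w : List Bool) :
    {r : ℝ | ∃ x : List Bool, x ≠ [] ∧ x <:+: w ∧ r = wexp x}.Finite := by
  refine (w.sublists.toFinset.finite_toSet.image wexp).subset ?_
  rintro r ⟨x, -, hx, rfl⟩
  exact ⟨x, by simpa using hx.sublist, rfl⟩

theorem getD_take_drop {w : List Bool} {s n i : ℕ} (hi : i < n) :
    ((w.drop s).take n).getD i false = w.getD (s + i) false := by
  simp [List.getD_eq_getElem?_getD, hi]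

theorem ce_lt_iff {α : ℝ} (hα : 3 < α) (w : List Bool) :
    ce w < α ↔ PowerFreeUpTo α w.length (fun i => w.getD i false) := by
  constructor
  · intro hw s n p hp hL hper
    have hpR : (1 : ℝ) ≤ p := by exact_mod_cast hp
    rcases lt_or_ge n p with hnp | hnp
    · have : (n : ℝ) < p := by exact_mod_cast hnp
      nlinarith
    · set x := (w.drop s).take n with hx
      have hlen : x.length = n := by simp [hx]; omega
      have hxp : HasPeriodW x p := by
        refine ⟨hp, by omega, fun i hi => ?_⟩
        rw [hx, getD_take_drop (by omega), getD_take_drop (by omega), ← Nat.add_assoc]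
        exact hper (s + i) (by omega) (by omega)
      have hx0 : x ≠ [] := by
        rintro h0
        rw [h0] at hlen
        simp at hlen
        omega
      have hle : wexp x ≤ ce w := le_csSup (finite_exponents w).bddAbove
        ⟨x, hx0, (List.take_prefix _ _).isInfix.trans (List.drop_suffix _ _).isInfix, rfl⟩
      have hper1 : HasPeriodW x (per x) := Nat.sInf_mem (s := {p | HasPeriodW x p}) ⟨p, hxp⟩
      have hper2 : per x ≤ p := Nat.sInf_le hxp
      have hper0 : (0 : ℝ) < per x := by exact_mod_cast hper1.1
      have hlt : wexp x < α := hle.trans_lt hw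
      rw [wexp, hlen, div_lt_iff₀ hper0] at hlt
      have : (per x : ℝ) ≤ p := by exact_mod_cast hper2
      nlinarith
  · intro hw
    rcases Set.eq_empty_or_nonempty
      {r : ℝ | ∃ x : List Bool, x ≠ [] ∧ x <:+: w ∧ r = wexp x} with h0 | h0
    · rw [ce, h0, Real.sSup_empty]
      linarith
    · obtain ⟨x, hx0, ⟨u, v, huv⟩, hr⟩ := h0.csSup_mem (finite_exponents w)
      rw [ce, hr]
      have hxp : HasPeriodW x x.length :=
        ⟨List.length_pos_of_ne_nil hx0, le_rfl, fun i hi => by omega⟩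
      have hper : HasPeriodW x (per x) :=
        Nat.sInf_mem (s := {p | HasPeriodW x p}) ⟨_, hxp⟩
      have hper0 : (0 : ℝ) < per x := by exact_mod_cast hper.1
      have hwl : w.length = u.length + x.length + v.length := by
        rw [← huv, List.length_append, List.length_append]
      have hget : ∀ i < x.length, w.getD (u.length + i) false = x.getD i false := by
        intro i hi
        rw [← huv, List.getD_append _ _ _ _ (by simp; omega),
          List.getD_append_right _ _ _ _ (by omega)]
        congr 1; omega
      rw [wexp, div_lt_iff₀ hper0]
      refine hw u.length x.length (per x) hper.1 (by omega) (fun i h1 h2 => ?_)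
      obtain ⟨j, rfl⟩ := Nat.exists_eq_add_of_le h1
      have h3 := hper.2.2 j (by omega)
      simp only
      rw [Nat.add_assoc, hget j (by omega), hget _ (by omega), h3]

theorem length_applyMorph {h0 h1 : List Bool} {k : ℕ} (hh0 : h0.length = k)
    (hh1 : h1.length = k) (w : List Bool) : (applyMorph h0 h1 w).length = k * w.length := by
  induction w with
  | nil => rfl
  | cons b w ih =>
    unfold applyMorph at ih ⊢
    rw [List.map_cons, List.flatten_cons, List.length_append, ih, List.length_cons]
    cases b <;> simp [hh0, hh1] <;> ring

theorem getD_tmFactor {k i : ℕ} (hi : i < k) : (tmFactor 0 k).getD i false = tm i := by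
  simp [tmFactor, List.getD_eq_getElem?_getD, hi]

theorem getD_wcompl_tmFactor {k i : ℕ} (hi : i < k) :
    (wcompl (tmFactor 0 k)).getD i false = !tm i := by
  simp [wcompl, tmFactor, List.getD_eq_getElem?_getD, hi]

theorem getD_applyMorph_tmFactor {k : ℕ} (w : List Bool) {i : ℕ} (hi : i < k * w.length) :
    (applyMorph (tmFactor 0 k) (wcompl (tmFactor 0 k)) w).getD i false =
      tmImage k (fun j => w.getD j false) i := by
  induction w generalizing i with
  | nil => simp at hi
  | cons b w ih =>
    have hk : 0 < k := Nat.pos_of_mul_pos_right (by omega : 0 < k * (b :: w).length)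
    rw [List.length_cons, Nat.mul_succ] at hi
    unfold applyMorph at ih ⊢
    rw [List.map_cons, List.flatten_cons]
    have hl : (bif b then wcompl (tmFactor 0 k) else tmFactor 0 k).length = k := by
      cases b <;> simp [wcompl, tmFactor]
    rcases lt_or_ge i k with h | h
    · rw [List.getD_append _ _ _ _ (by omega), tmImage, Nat.div_eq_of_lt h, Nat.mod_eq_of_lt h]
      cases b
      · simpa using getD_tmFactor h
      · simpa using getD_wcompl_tmFactor h
    · obtain ⟨j, rfl⟩ := Nat.exists_eq_add_of_le h
      rw [List.getD_append_right _ _ _ _ (by omega), hl, Nat.add_sub_cancel_left,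
        ih (by omega), tmImage, tmImage, Nat.add_div_left _ hk, Nat.add_mod_left]
      simp

/-- for every real `α > 3` and `k ≥ 1`, the truncated Thue–Morse
morphism `h_k` is `α`-free. -/
theorem stmt1 (α : ℝ) (hα : 3 < α) (k : ℕ) (hk : 1 ≤ k) (w : List Bool)
    (hw : ce w < α) :
    ce (applyMorph (tmFactor 0 k) (wcompl (tmFactor 0 k)) w) < α := by
  rw [ce_lt_iff hα] at hw ⊢
  rw [length_applyMorph (k := k) (by simp [tmFactor]) (by simp [wcompl, tmFactor])]
  exact (hw.tmImage hα hk).congr (fun i hi => (getD_applyMorph_tmFactor w hi).symm)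
end

section
/- Let a ∈ {0,1} and n ≥ 1. In the word μ^n(a a) (which has length 2^{n+1}), the only positions at which a factor equal to an n-block (that is, equal to μ^n(0) or μ^n(1)) occurs are positions 0, 2^{n−1}, and 2^n. -/
theorem mu_nil : mu [] = [] := rfl

theorem mu_cons (c : Bool) (w : List Bool) : mu (c :: w) = c :: (!c) :: mu w := by
  cases c <;> simp [mu, applyMorph]

theorem length_mu (w : List Bool) : (mu w).length = 2 * w.length := by
  induction w with
  | nil => rfl
  | cons c w ih => simp only [mu_cons, List.length_cons, ih]; omega

theorem mu_injective : Function.Injective mu := by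
  intro v
  induction v with
  | nil =>
    intro w h
    cases w with
    | nil => rfl
    | cons d w => simp [mu_nil, mu_cons] at h
  | cons c v ih =>
    intro w h
    cases w with
    | nil => simp [mu_nil, mu_cons] at h
    | cons d w =>
      simp only [mu_cons, List.cons.injEq] at h
      rw [h.1, ih h.2.2]

theorem drop_two_mul_mu (j : ℕ) (w : List Bool) : (mu w).drop (2 * j) = mu (w.drop j) := by
  induction j generalizing w with
  | zero => rfl
  | succ j ih =>
    cases w with
    | nil => simp [mu_nil]
    | cons c w => simp [mu_cons, Nat.mul_succ, ih]

theorem take_two_mul_mu (j : ℕ) (w : List Bool) : (mu w).take (2 * j) = mu (w.take j) := by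
  induction j generalizing w with
  | zero => simp [mu_nil]
  | succ j ih =>
    cases w with
    | nil => simp [mu_nil]
    | cons c w => simp [mu_cons, Nat.mul_succ, ih]

theorem occursAt_mu_two_mul (x w : List Bool) (j : ℕ) :
    OccursAt (mu x) (mu w) (2 * j) ↔ OccursAt x w j := by
  unfold OccursAt
  rw [length_mu, length_mu, drop_two_mul_mu, take_two_mul_mu, mu_injective.eq_iff]
  exact and_congr_left fun _ => by omega

/-- The image under `mu` of a word starting with two distinct letters has equal letters at
positions `1` and `2`, so it cannot occur at an odd position of an image under `mu`. -/
theorem not_occursAt_mu_odd (b : Bool) (y w : List Bool) (j : ℕ) :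
    ¬ OccursAt (mu (b :: (!b) :: y)) (mu w) (2 * j + 1) := by
  rintro ⟨-, h⟩
  rw [← List.drop_drop, drop_two_mul_mu] at h
  generalize w.drop j = u at h
  rcases u with _ | ⟨c, _ | ⟨d, v⟩⟩ <;> simp [mu_nil, mu_cons] at h
  obtain ⟨-, h₁, h₂, -⟩ := h
  simp [h₁] at h₂

theorem iterate_mu_singleton_eq_cons (b : Bool) (n : ℕ) : ∃ y, mu^[n] [b] = b :: y := by
  induction n with
  | zero => exact ⟨[], rfl⟩
  | succ n ih =>
    obtain ⟨y, hy⟩ := ih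
    exact ⟨_, by rw [Function.iterate_succ_apply', hy, mu_cons]⟩

theorem exists_occursAt_mu_singleton_iff (a : Bool) (i : ℕ) :
    (∃ b : Bool, OccursAt (mu [b]) (mu [a, a]) i) ↔ (i = 0 ∨ i = 1 ∨ i = 2) := by
  constructor
  · rintro ⟨b, h, -⟩
    simp only [length_mu, List.length_cons, List.length_nil] at h
    omega
  · rintro (rfl | rfl | rfl)
    · exact ⟨a, by simp [OccursAt, mu_cons, mu_nil]⟩
    · exact ⟨!a, by simp [OccursAt, mu_cons, mu_nil]⟩
    · exact ⟨a, by simp [OccursAt, mu_cons, mu_nil]⟩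

/-- in the word `μⁿ(a a)` (with `n ≥ 1`), an `n`-block
(`μⁿ(0)` or `μⁿ(1)`) occurs exactly at the positions `0`, `2^(n-1)` and `2ⁿ`. -/
theorem stmt4 (a : Bool) (n : ℕ) (hn : 1 ≤ n) (i : ℕ) :
    (∃ b : Bool, OccursAt (mu^[n] [b]) (mu^[n] [a, a]) i) ↔
      (i = 0 ∨ i = 2 ^ (n - 1) ∨ i = 2 ^ n) := by
  induction n, hn using Nat.le_induction generalizing i with
  | base => exact exists_occursAt_mu_singleton_iff a i
  | succ n hn ih =>
    obtain ⟨m, rfl⟩ : ∃ m, n = m + 1 := ⟨n - 1, by omega⟩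
    simp only [Function.iterate_succ_apply' mu (m + 1)]
    obtain ⟨j, rfl | rfl⟩ := Nat.even_or_odd' i
    · simp only [occursAt_mu_two_mul, ih, Nat.add_sub_cancel, pow_succ]
      omega
    · refine iff_of_false ?_ ?_
      · rintro ⟨b, h⟩
        obtain ⟨y, hy⟩ := iterate_mu_singleton_eq_cons b m
        rw [Function.iterate_succ_apply' mu m [b], hy, mu_cons] at h
        exact not_occursAt_mu_odd b _ _ j h
      · simp only [Nat.add_sub_cancel, pow_succ]
        omega
end
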